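/- arXiv:2511.12272 — 3 statements merged into one kernel-verified Lean document; each statement's English description precedes it below -/
import Mathlib

section
/- Let X be a complex Hilbert space and let T be an invertible bounded linear operator on X. Then T has the shadowing property if and only if the adjoint operator T* is uniformly expansive; equivalently, if and only if the approximate point spectrum of T* is disjoint from the unit circle: σ_a(T*) ∩ 𝕋 = ∅. -/
open Filter Topology

noncomputable section

variable {X : Type*} [NormedAddCommGroup X] [InnerProductSpace ℂ X] [CompleteSpace X]

/-- `T` has the shadowing property. -/
def ShadowingProperty {Y : Type*} [NormedAddCommGroup Y] [NormedSpace ℂ Y]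
    (T : (Y →L[ℂ] Y)ˣ) : Prop :=
  ∀ ε > (0 : ℝ), ∃ δ > (0 : ℝ), ∀ x : ℤ → Y,
    (∀ n : ℤ, ‖x (n + 1) - (T : Y →L[ℂ] Y) (x n)‖ ≤ δ) →
      ∃ y : Y, ∀ n : ℤ, ‖x n - ((T ^ n : (Y →L[ℂ] Y)ˣ) : Y →L[ℂ] Y) y‖ ≤ ε

/-- An invertible operator `S` is uniformly expansive if there is a positive integer `n`
such that every unit vector `x` satisfies `‖Sⁿ x‖ ≥ 2` or `‖S⁻ⁿ x‖ ≥ 2`. -/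
def UniformlyExpansive {Y : Type*} [NormedAddCommGroup Y] [NormedSpace ℂ Y]
    (S : (Y →L[ℂ] Y)ˣ) : Prop :=
  ∃ n : ℕ, 0 < n ∧ ∀ x : Y, ‖x‖ = 1 →
    2 ≤ ‖((S ^ (n : ℤ) : (Y →L[ℂ] Y)ˣ) : Y →L[ℂ] Y) x‖ ∨
    2 ≤ ‖((S ^ (-(n : ℤ)) : (Y →L[ℂ] Y)ˣ) : Y →L[ℂ] Y) x‖

/-- The approximate point spectrum of `T`: the set of `λ ∈ ℂ` such that `λI - T` is not
bounded below. -/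
def ApproxPointSpectrum {Y : Type*} [NormedAddCommGroup Y] [NormedSpace ℂ Y]
    (T : Y →L[ℂ] Y) : Set ℂ :=
  {l : ℂ | ¬ ∃ α > (0 : ℝ), ∀ x : Y, α * ‖x‖ ≤ ‖(l • (1 : Y →L[ℂ] Y) - T) x‖}

section helpers

lemma aux_zpow_add {Y : Type*} [NormedAddCommGroup Y] [NormedSpace ℂ Y]
    (T : (Y →L[ℂ] Y)ˣ) (m n : ℤ) (x : Y) :
    ((T ^ (m + n) : (Y →L[ℂ] Y)ˣ) : Y →L[ℂ] Y) x =
      ((T ^ m : (Y →L[ℂ] Y)ˣ) : Y →L[ℂ] Y) (((T ^ n : (Y →L[ℂ] Y)ˣ) : Y →L[ℂ] Y) x) := by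
  rw [zpow_add, Units.val_mul, mul_apply_eq_comp]

lemma aux_zpow_zero {Y : Type*} [NormedAddCommGroup Y] [NormedSpace ℂ Y]
    (T : (Y →L[ℂ] Y)ˣ) (x : Y) :
    ((T ^ (0 : ℤ) : (Y →L[ℂ] Y)ˣ) : Y →L[ℂ] Y) x = x := by
  simp

lemma aux_zpow_succ {Y : Type*} [NormedAddCommGroup Y] [NormedSpace ℂ Y]
    (T : (Y →L[ℂ] Y)ˣ) (n m : ℤ) (h : m = n + 1) (x : Y) :
    (T : Y →L[ℂ] Y) (((T ^ n : (Y →L[ℂ] Y)ˣ) : Y →L[ℂ] Y) x) =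
    ((T ^ m : (Y →L[ℂ] Y)ˣ) : Y →L[ℂ] Y) x := by
  rw [h, add_comm, aux_zpow_add, zpow_one]

/-- uniform expansivity with constant 2 gives bounded below on the circle -/
lemma aux_B_C {Y : Type*} [NormedAddCommGroup Y] [NormedSpace ℂ Y]
    (S : (Y →L[ℂ] Y)ˣ) (hS : UniformlyExpansive S) (l : ℂ) (hl : ‖l‖ = 1) :
    ∃ α > (0 : ℝ), ∀ x : Y, α * ‖x‖ ≤ ‖(l • (1 : Y →L[ℂ] Y) - (S : Y →L[ℂ] Y)) x‖ := by
  obtain ⟨n, hn, hexp⟩ := hS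
  have hcomm : Commute (l • (1 : Y →L[ℂ] Y)) (S : Y →L[ℂ] Y) :=
    (Commute.one_left _).smul_left l
  have hQ := hcomm.geom_sum₂_mul n
  set Q := ∑ i ∈ Finset.range n, (l • (1 : Y →L[ℂ] Y)) ^ i * (S : Y →L[ℂ] Y) ^ (n - 1 - i)
  have hscale : ∀ x : Y, 2 * ‖x‖ ≤ ‖((S ^ (n : ℤ) : (Y →L[ℂ] Y)ˣ) : Y →L[ℂ] Y) x‖ ∨
    2 * ‖x‖ ≤ ‖((S ^ (-(n : ℤ)) : (Y →L[ℂ] Y)ˣ) : Y →L[ℂ] Y) x‖ := by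
    intro x
    by_cases hx : x = 0
    · left; simp [hx]
    have hx' : 0 < ‖x‖ := norm_pos_iff.mpr hx
    have := hexp (((‖x‖⁻¹ : ℝ) : ℂ) • x) (by rw [norm_smul]; simp [hx])
    simp only [map_smul, norm_smul, Complex.norm_real, norm_inv, norm_norm] at this
    rcases this with h | h
    · left; rw [inv_mul_eq_div, le_div_iff₀ hx'] at h; exact h
    · right; rw [inv_mul_eq_div, le_div_iff₀ hx'] at h; exact h
  set V : Y →L[ℂ] Y := ((S ^ (-(n : ℤ)) : (Y →L[ℂ] Y)ˣ) : Y →L[ℂ] Y) with hV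
  have hC : 0 < 1 + ‖Q‖ + ‖V‖ * ‖Q‖ := by positivity
  refine ⟨(1 + ‖Q‖ + ‖V‖ * ‖Q‖)⁻¹, inv_pos.mpr hC, fun x => ?_⟩
  rw [inv_mul_le_iff₀ hC]
  set e := (l • (1 : Y →L[ℂ] Y) - (S : Y →L[ℂ] Y)) x with he
  have h1 : l ^ n • x - ((S ^ (n : ℤ) : (Y →L[ℂ] Y)ˣ) : Y →L[ℂ] Y) x = Q e := by
    have := congrArg (fun A : Y →L[ℂ] Y => A x) hQ
    simp only [mul_apply_eq_comp] at this
    rw [he, this]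
    simp [smul_pow]
  have hln : ‖l ^ n‖ = 1 := by simp [hl]
  have hQe : ‖Q e‖ ≤ ‖Q‖ * ‖e‖ := Q.le_opNorm e
  have hVQe : ‖V (Q e)‖ ≤ ‖V‖ * (‖Q‖ * ‖e‖) :=
    (V.le_opNorm _).trans (mul_le_mul_of_nonneg_left hQe (norm_nonneg _))
  have e0 := norm_nonneg e
  have e1 : 0 ≤ ‖Q‖ * ‖e‖ := by positivity
  have e2 : 0 ≤ ‖V‖ * (‖Q‖ * ‖e‖) := by positivity
  rcases hscale x with h | h
  · have h2 : ((S ^ (n : ℤ) : (Y →L[ℂ] Y)ˣ) : Y →L[ℂ] Y) x = l ^ n • x - Q e := by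
      rw [← h1]; abel
    rw [h2] at h
    have h3 := norm_sub_le (l ^ n • x) (Q e)
    rw [norm_smul, hln, one_mul] at h3
    nlinarith
  · have h2 : l ^ n • V x = x + V (Q e) := by
      rw [← h1, map_sub, map_smul, hV, ← aux_zpow_add]
      simp
    have h3 : ‖V x‖ ≤ ‖x‖ + ‖V (Q e)‖ := by
      calc ‖V x‖ = ‖l ^ n • V x‖ := by rw [norm_smul, hln, one_mul]
        _ ≤ _ := by rw [h2]; exact norm_add_le _ _
    nlinarith

lemma aux_A_C {X : Type*} [NormedAddCommGroup X] [InnerProductSpace ℂ X] [CompleteSpace X]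
    (T : (X →L[ℂ] X)ˣ) (hT : ShadowingProperty T) (l : ℂ) (hl : ‖l‖ = 1) :
    ∃ α > (0 : ℝ), ∀ x : X, α * ‖x‖ ≤
      ‖(l • (1 : X →L[ℂ] X) - ContinuousLinearMap.adjoint (T : X →L[ℂ] X)) x‖ := by
  obtain ⟨δ, hδ, hsh⟩ := hT 1 one_pos
  refine ⟨δ, hδ, fun y => ?_⟩
  by_cases hy : y = 0
  · simp [hy]
  have hy' : 0 < ‖y‖ := norm_pos_iff.mpr hy
  set μ : ℂ := starRingEnd ℂ l with hμ
  have hμ1 : ‖μ‖ = 1 := by simp [hμ, hl]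
  have hμ0 : μ ≠ 0 := by intro h; simp [h] at hμ1
  set u : X := ((δ / ‖y‖ : ℝ) : ℂ) • y with hu
  have hun : ‖u‖ = δ := by
    rw [hu, norm_smul, Complex.norm_real, Real.norm_eq_abs, abs_of_pos (by positivity)]
    field_simp
  have hyu : inner ℂ y u = ((δ * ‖y‖ : ℝ) : ℂ) := by
    rw [hu, inner_smul_right, inner_self_eq_norm_sq_to_K]
    have : (‖y‖ : ℂ) ≠ 0 := by exact_mod_cast hy'.ne'
    push_cast
    field_simp
    simp
  let g : ℕ → X := fun n => Nat.rec (0 : X) (fun k v => (T : X →L[ℂ] X) v + μ ^ k • u) n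
  have hg0 : g 0 = 0 := rfl
  have hgs : ∀ k, g (k + 1) = (T : X →L[ℂ] X) (g k) + μ ^ k • u := fun k => rfl
  obtain ⟨v, hv⟩ := hsh (fun n => g n.toNat) (by
    intro n
    rcases lt_or_ge n 0 with h | h
    · have h1 : (n + 1).toNat = 0 := by omega
      have h2 : n.toNat = 0 := by omega
      simp only [h1, h2, hg0, map_zero, sub_zero, norm_zero]; exact hδ.le
    · have h1 : (n + 1).toNat = n.toNat + 1 := by omega
      simp only [h1, hgs, add_sub_cancel_left, norm_smul, norm_pow, hμ1, one_pow, one_mul, hun]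
      exact le_refl _)
  let w : ℕ → X := fun n => g n - ((T ^ (n : ℤ) : (X →L[ℂ] X)ˣ) : X →L[ℂ] X) v
  have hw1 : ∀ n, ‖w n‖ ≤ 1 := fun n => hv n
  have hws : ∀ n, w (n + 1) = (T : X →L[ℂ] X) (w n) + μ ^ n • u := by
    intro n
    simp only [w, hgs, map_sub]
    rw [aux_zpow_succ T n ((n + 1 : ℕ) : ℤ) (by push_cast; ring)]
    abel
  set e := (l • (1 : X →L[ℂ] X) - ContinuousLinearMap.adjoint (T : X →L[ℂ] X)) y with he
  let φ : ℕ → ℂ := fun n => inner ℂ y ((μ ^ n)⁻¹ • w n)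
  have hφ : ∀ n, ‖φ n‖ ≤ ‖y‖ := by
    intro n
    refine (norm_inner_le_norm _ _).trans ?_
    rw [norm_smul, norm_inv, norm_pow, hμ1, one_pow, inv_one, one_mul]
    nlinarith [hw1 n]
  have hstep : ∀ n, μ * (φ (n + 1) - φ n) =
      ((δ * ‖y‖ : ℝ) : ℂ) - inner ℂ e ((μ ^ n)⁻¹ • w n) := by
    intro n
    have h1 : inner ℂ e ((μ ^ n)⁻¹ • w n) =
        μ * φ n - (μ ^ n)⁻¹ * inner ℂ y ((T : X →L[ℂ] X) (w n)) := by
      simp only [he, φ, sub_apply, inner_sub_left,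
        ContinuousLinearMap.adjoint_inner_left, smul_apply,
        one_apply_eq_self, inner_smul_left, inner_smul_right, hμ]
      ring
    have h2 : μ * φ (n + 1) = (μ ^ n)⁻¹ * inner ℂ y ((T : X →L[ℂ] X) (w n)) + inner ℂ y u := by
      simp only [φ, hws, inner_smul_right, inner_add_right, pow_succ]
      field_simp
    rw [mul_sub, h1, h2, hyu]; ring
  have hsum : ∀ N : ℕ, (N : ℝ) * (δ * ‖y‖ - ‖e‖) ≤ 2 * ‖y‖ := by
    intro N
    have h1 : μ * (φ N - φ 0) + ∑ n ∈ Finset.range N, inner ℂ e ((μ ^ n)⁻¹ • w n)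
        = ((N * (δ * ‖y‖) : ℝ) : ℂ) := by
      rw [← Finset.sum_range_sub, Finset.mul_sum, ← Finset.sum_add_distrib]
      simp only [hstep, sub_add_cancel]
      simp
    have h2 : ‖((N * (δ * ‖y‖) : ℝ) : ℂ)‖ ≤ 2 * ‖y‖ + N * ‖e‖ := by
      rw [← h1]
      refine (norm_add_le _ _).trans (add_le_add ?_ ?_)
      · rw [norm_mul, hμ1, one_mul]
        linarith [norm_sub_le (φ N) (φ 0), hφ N, hφ 0]
      · refine (norm_sum_le_of_le (n := fun _ => ‖e‖) _ ?_).trans ?_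
        · intro n _
          refine (norm_inner_le_norm _ _).trans ?_
          rw [norm_smul, norm_inv, norm_pow, hμ1, one_pow, inv_one, one_mul]
          nlinarith [hw1 n, norm_nonneg e]
        · simp
    rw [Complex.norm_real, Real.norm_eq_abs, abs_of_nonneg (by positivity)] at h2
    linarith
  by_contra hcon
  push Not at hcon
  have hgap : 0 < δ * ‖y‖ - ‖e‖ := by linarith
  obtain ⟨N, hN⟩ := exists_nat_gt (2 * ‖y‖ / (δ * ‖y‖ - ‖e‖))
  rw [div_lt_iff₀ hgap] at hN
  linarith [hsum N]

lemma aux_compact {Y : Type*} [NormedAddCommGroup Y] [NormedSpace ℂ Y] (S : Y →L[ℂ] Y)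
    (h : ∀ l : ℂ, ‖l‖ = 1 → ∃ α > (0 : ℝ), ∀ x : Y, α * ‖x‖ ≤ ‖l • x - S x‖) :
    ∃ α > (0 : ℝ), ∀ l : ℂ, ‖l‖ = 1 → ∀ x : Y, α * ‖x‖ ≤ ‖l • x - S x‖ := by
  have := (isCompact_sphere (0 : ℂ) 1).induction_on
    (p := fun s => ∃ α > (0 : ℝ), ∀ l ∈ s, ∀ x : Y, α * ‖x‖ ≤ ‖l • x - S x‖)
    ⟨1, one_pos, by simp⟩
    (fun s t hst ⟨α, h1, h2⟩ => ⟨α, h1, fun l hl => h2 l (hst hl)⟩)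
    (fun s t ⟨α, h1, h2⟩ ⟨β, h3, h4⟩ => ⟨min α β, lt_min h1 h3, fun l hl x => by
      rcases hl with hl | hl
      · exact (mul_le_mul_of_nonneg_right (min_le_left _ _) (norm_nonneg _)).trans (h2 l hl x)
      · exact (mul_le_mul_of_nonneg_right (min_le_right _ _) (norm_nonneg _)).trans (h4 l hl x)⟩)
    (fun l hl => by
      obtain ⟨α, h1, h2⟩ := h l (by simpa using hl)
      refine ⟨Metric.ball l (α / 2), mem_nhdsWithin_of_mem_nhds (Metric.ball_mem_nhds _ (by positivity)),
        α / 2, by positivity, fun m hm x => ?_⟩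
      have h3 : ‖m - l‖ < α / 2 := by simpa [dist_eq_norm] using hm
      have h4 : l • x - S x = (m • x - S x) - (m - l) • x := by rw [sub_smul]; abel
      have h5 := h2 x
      rw [h4] at h5
      have h6 := norm_sub_le (m • x - S x) ((m - l) • x)
      rw [norm_smul] at h6
      nlinarith [norm_nonneg x])
  obtain ⟨α, h1, h2⟩ := this
  exact ⟨α, h1, fun l hl => h2 l (by simpa using hl)⟩

lemma aux_parseval {X : Type*} [NormedAddCommGroup X] [InnerProductSpace ℂ X]
    (L : ℕ) (hL : 0 < L) (ζ : ℂ) (hζ : IsPrimitiveRoot ζ L) (z : ℕ → X) :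
    ∑ j ∈ Finset.range L, ‖∑ k ∈ Finset.range L, (ζ ^ j) ^ k • z k‖ ^ 2 =
      L * ∑ k ∈ Finset.range L, ‖z k‖ ^ 2 := by
  have hζn : ‖ζ‖ = 1 := hζ.norm'_eq_one hL.ne'
  have hζ0 : ζ ≠ 0 := by intro h; simp [h] at hζn
  have hconj : starRingEnd ℂ ζ = ζ⁻¹ := by
    rw [Complex.inv_def, Complex.normSq_eq_norm_sq, hζn]; simp
  have horth : ∀ k < L, ∀ m < L, ∑ j ∈ Finset.range L, (ζ⁻¹ ^ j) ^ k * (ζ ^ j) ^ m =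
      if k = m then (L : ℂ) else 0 := by
    intro k hk m hm
    have h1 : ∀ j, (ζ⁻¹ ^ j) ^ k * (ζ ^ j) ^ m = ((ζ ^ k)⁻¹ * ζ ^ m) ^ j := by
      intro j
      rw [mul_pow, inv_pow, inv_pow, inv_pow, ← pow_mul, ← pow_mul, ← pow_mul, ← pow_mul, mul_comm j k, mul_comm j m]
    simp only [h1]
    split_ifs with hkm
    · subst hkm
      simp [hζ0]
    · have hne : (ζ ^ k)⁻¹ * ζ ^ m ≠ 1 := by
        intro h
        apply hkm
        apply hζ.pow_inj hk hm
        field_simp at h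
        exact h.symm
      have hpow : ((ζ ^ k)⁻¹ * ζ ^ m) ^ L = 1 := by
        rw [mul_pow, inv_pow, ← pow_mul, ← pow_mul, mul_comm k, mul_comm m, pow_mul, pow_mul, hζ.pow_eq_one]
        simp
      rw [geom_sum_eq hne, hpow]; simp
  have key : ((∑ j ∈ Finset.range L, ‖∑ k ∈ Finset.range L, (ζ ^ j) ^ k • z k‖ ^ 2 : ℝ) : ℂ) =
      ((L * ∑ k ∈ Finset.range L, ‖z k‖ ^ 2 : ℝ) : ℂ) := by
    push_cast
    have h1 : ∀ x : X, ((‖x‖ : ℂ)) ^ 2 = inner ℂ x x := fun x => by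
      rw [inner_self_eq_norm_sq_to_K]; rfl
    simp only [h1, sum_inner, inner_sum, inner_smul_left, inner_smul_right, map_pow, hconj]
    rw [Finset.sum_comm, Finset.mul_sum]
    refine Finset.sum_congr rfl fun k hk => ?_
    simp only [Finset.mul_sum]
    rw [Finset.sum_comm]
    simp only [← mul_assoc, ← Finset.sum_mul]
    simp only [mul_comm ((ζ ^ _) ^ _) ((ζ⁻¹ ^ _) ^ _)]
    rw [Finset.sum_eq_single k]
    · rw [horth k (Finset.mem_range.mp hk) k (Finset.mem_range.mp hk)]; simp
    · intro m hm hmk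
      have := horth m (Finset.mem_range.mp hm) k (Finset.mem_range.mp hk)
      have h2 := horth k (Finset.mem_range.mp hk) m (Finset.mem_range.mp hm)
      rw [if_neg hmk] at this
      rw [if_neg hmk.symm] at h2
      first
        | rw [this, zero_mul]
        | rw [h2, zero_mul]
        | (simp only [mul_comm] at this h2 ⊢; simp [this, h2])
    · intro h; exact absurd hk h
  exact_mod_cast key

lemma aux_key {X : Type*} [NormedAddCommGroup X] [InnerProductSpace ℂ X] (S : X →L[ℂ] X)
    (α : ℝ) (hα : 0 < α) (h : ∀ l : ℂ, ‖l‖ = 1 → ∀ x : X, α * ‖x‖ ≤ ‖l • x - S x‖)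
    (L : ℕ) (hL : 0 < L) (x : X) :
    α ^ 2 * ∑ k ∈ Finset.range L, ‖(S ^ k) x‖ ^ 2 ≤ (‖x‖ + ‖(S ^ L) x‖) ^ 2 := by
  obtain ⟨ζ, hζ⟩ : ∃ ζ : ℂ, IsPrimitiveRoot ζ L := ⟨_, Complex.isPrimitiveRoot_exp L hL.ne'⟩
  have hζn : ‖ζ‖ = 1 := hζ.norm'_eq_one hL.ne'
  have hp := aux_parseval L hL ζ hζ (fun k => (S ^ k) x)
  have hj : ∀ j ∈ Finset.range L,
      α ^ 2 * ‖∑ k ∈ Finset.range L, (ζ ^ j) ^ k • (S ^ k) x‖ ^ 2 ≤ (‖x‖ + ‖(S ^ L) x‖) ^ 2 := by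
    intro j _
    set l := ζ ^ j with hl
    have hl1 : ‖l‖ = 1 := by simp [hl, hζn]
    have hl0 : l ≠ 0 := by intro h; simp [h] at hl1
    have hlL : l ^ L = 1 := by rw [hl, ← pow_mul, mul_comm, pow_mul, hζ.pow_eq_one, one_pow]
    set y := ∑ k ∈ Finset.range L, l ^ k • (S ^ k) x with hy
    have h1 : y - l • S y = x - (S ^ L) x := by
      have : ∀ k, l • S (l ^ k • (S ^ k) x) = l ^ (k + 1) • (S ^ (k + 1)) x := by
        intro k
        rw [map_smul, smul_smul, pow_succ', pow_succ', mul_apply_eq_comp]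
      rw [hy, map_sum, Finset.smul_sum]
      simp only [this]
      rw [← Finset.sum_sub_distrib, Finset.sum_range_sub' (fun k => l ^ k • (S ^ k) x), hlL]
      simp
    have h2 := h l⁻¹ (by simp [hl1]) y
    have h3 : l⁻¹ • y - S y = l⁻¹ • (x - (S ^ L) x) := by
      rw [← h1, smul_sub, smul_smul, inv_mul_cancel₀ hl0, one_smul]
    rw [h3, norm_smul, norm_inv, hl1, inv_one, one_mul] at h2
    rw [← mul_pow]
    exact pow_le_pow_left₀ (by positivity) (h2.trans (norm_sub_le _ _)) 2
  have hs := Finset.sum_le_sum hj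
  rw [← Finset.mul_sum, hp] at hs
  simp only [Finset.sum_const, Finset.card_range, nsmul_eq_mul] at hs
  have hLp : (0 : ℝ) < L := by exact_mod_cast hL
  refine le_of_mul_le_mul_left ?_ hLp
  linarith

lemma aux_real (f : ℤ → ℝ) (hf : ∀ k, 0 ≤ f k) (h0 : f 0 = 1) (α K : ℝ) (hα : 0 < α) (hK : 0 < K)
    (h : ∀ (p : ℤ) (L : ℕ), 0 < L →
      α ^ 2 * ∑ k ∈ Finset.range L, f (p + k) ^ 2 ≤ (f p + f (p + L)) ^ 2)
    (n : ℕ) (hn1 : 16 * K ^ 2 / α ^ 4 < n) (hn2 : 4 * K ^ 2 / α ^ 2 < n)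
    (h1 : f n < K) (h2 : f (-n) < K) : False := by
  have hn : (0 : ℝ) < n := lt_of_le_of_lt (by positivity) hn2
  have hn' : 0 < n := by exact_mod_cast hn
  set c := 4 * K ^ 2 / (α ^ 2 * n) with hc
  have hc1 : c < 1 := by
    rw [hc, div_lt_one (by positivity)]
    rw [div_lt_iff₀ (by positivity)] at hn2
    linarith
  have hc2 : 4 * c < α ^ 2 := by
    rw [hc, ← mul_div_assoc, div_lt_iff₀ (by positivity)]
    rw [div_lt_iff₀ (by positivity)] at hn1
    linarith
  have hcn : α ^ 2 * (n * c) = 4 * K ^ 2 := by rw [hc]; field_simp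
  have hbig := h (-n) (2 * n) (by omega)
  have hsum : α ^ 2 * ∑ k ∈ Finset.range (2 * n), f (-n + k) ^ 2 < α ^ 2 * (n * c) := by
    rw [hcn]
    refine hbig.trans_lt ?_
    have : (-(n : ℤ) + ((2 * n : ℕ) : ℤ)) = n := by push_cast; ring
    rw [this]
    nlinarith [hf n, hf (-n)]
  have hsum' := lt_of_mul_lt_mul_left hsum (by positivity)
  rw [two_mul, Finset.sum_range_add] at hsum'
  have hp1 : 0 ≤ ∑ k ∈ Finset.range n, f (-n + k) ^ 2 := Finset.sum_nonneg fun _ _ => sq_nonneg _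
  have hp2 : 0 ≤ ∑ k ∈ Finset.range n, f (-n + (n + k : ℕ)) ^ 2 :=
    Finset.sum_nonneg fun _ _ => sq_nonneg _
  have hex : ∀ F : ℕ → ℝ, ∑ k ∈ Finset.range n, F k < n * c → ∃ k < n, F k < c := by
    intro F hF
    by_contra hcon
    push Not at hcon
    have := Finset.card_nsmul_le_sum (Finset.range n) F c (fun k hk => hcon k (Finset.mem_range.mp hk))
    simp at this
    linarith
  obtain ⟨i, hi, hic⟩ := hex (fun k => f (-n + k) ^ 2) (by linarith)
  obtain ⟨j, hj, hjc⟩ := hex (fun k => f (-n + (n + k : ℕ)) ^ 2) (by linarith)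
  have e1 : (-(n : ℤ) + (n + j : ℕ)) = j := by push_cast; ring
  simp only [e1] at hjc hic
  have hj0 : j ≠ 0 := by
    rintro rfl
    simp [h0] at hjc
    linarith
  have hfin := h (-n + i) (n - i + j) (by omega)
  have e2 : (-(n : ℤ) + i) + (n - i + j : ℕ) = j := by omega
  rw [e2] at hfin
  have hone : (1 : ℝ) ≤ ∑ k ∈ Finset.range (n - i + j), f (-n + i + k) ^ 2 := by
    have := Finset.single_le_sum (f := fun k : ℕ => f (-n + i + k) ^ 2)
      (fun _ _ => sq_nonneg _) (Finset.mem_range.mpr (show n - i < n - i + j by omega))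
    have e3 : (-(n : ℤ) + i) + (n - i : ℕ) = 0 := by omega
    simp only [e3, h0] at this
    simpa using this
  have : α ^ 2 * 1 ≤ 4 * c := by
    refine (mul_le_mul_of_nonneg_left hone (by positivity)).trans (hfin.trans ?_)
    nlinarith [sq_nonneg (f (-n + i) - f j)]
  linarith

lemma aux_C_B {X : Type*} [NormedAddCommGroup X] [InnerProductSpace ℂ X] (S : (X →L[ℂ] X)ˣ)
    (h : ∀ l : ℂ, ‖l‖ = 1 → ∃ α > (0 : ℝ), ∀ x : X, α * ‖x‖ ≤ ‖l • x - (S : X →L[ℂ] X) x‖)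
    (K : ℝ) (hK : 0 < K) :
    ∃ n : ℕ, 0 < n ∧ ∀ x : X, ‖x‖ = 1 →
    K ≤ ‖((S ^ (n : ℤ) : (X →L[ℂ] X)ˣ) : X →L[ℂ] X) x‖ ∨
    K ≤ ‖((S ^ (-(n : ℤ)) : (X →L[ℂ] X)ˣ) : X →L[ℂ] X) x‖ := by
  obtain ⟨α, hα, hb⟩ := aux_compact _ h
  obtain ⟨n, hn⟩ := exists_nat_gt (max (16 * K ^ 2 / α ^ 4) (4 * K ^ 2 / α ^ 2))
  obtain ⟨hn1, hn2⟩ := max_lt_iff.mp hn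
  have hn0 : (0 : ℝ) < n := lt_of_le_of_lt (by positivity) hn2
  refine ⟨n, by exact_mod_cast hn0, fun x hx => ?_⟩
  by_contra hcon
  push Not at hcon
  refine aux_real (fun k => ‖((S ^ k : (X →L[ℂ] X)ˣ) : X →L[ℂ] X) x‖) (fun _ => norm_nonneg _)
    (by simpa using hx) α K hα hK ?_ n hn1 hn2 hcon.1 hcon.2
  intro p L hL
  have := aux_key (S : X →L[ℂ] X) α hα hb L hL (((S ^ p : (X →L[ℂ] X)ˣ) : X →L[ℂ] X) x)
  have e : ∀ k : ℕ, ((S : X →L[ℂ] X) ^ k) (((S ^ p : (X →L[ℂ] X)ˣ) : X →L[ℂ] X) x) =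
      ((S ^ (p + k) : (X →L[ℂ] X)ˣ) : X →L[ℂ] X) x := by
    intro k
    rw [add_comm, aux_zpow_add, zpow_natCast, Units.val_pow_eq_pow_val]
  simpa only [e] using this

lemma aux_dec {X : Type*} [NormedAddCommGroup X] [InnerProductSpace ℂ X] [CompleteSpace X]
    (A B : X →L[ℂ] X)
    (h : ∀ x : X, ‖x‖ = 1 → 4 ≤ ‖ContinuousLinearMap.adjoint A x‖ ∨
      4 ≤ ‖ContinuousLinearMap.adjoint B x‖) (v : X) :
    ∃ a b : X, v = A a + B b ∧ ‖a‖ ≤ ‖v‖ / 4 ∧ ‖b‖ ≤ ‖v‖ / 4 := by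
  set A' := ContinuousLinearMap.adjoint A
  set B' := ContinuousLinearMap.adjoint B
  have hscale : ∀ x : X, 16 * ‖x‖ ^ 2 ≤ ‖A' x‖ ^ 2 + ‖B' x‖ ^ 2 := by
    intro x
    by_cases hx : x = 0
    · simp [hx]
    have hx' : 0 < ‖x‖ := norm_pos_iff.mpr hx
    have := h (((‖x‖⁻¹ : ℝ) : ℂ) • x) (by rw [norm_smul]; simp [hx])
    simp only [map_smul, norm_smul, Complex.norm_real, norm_inv, norm_norm] at this
    rcases this with h | h <;> rw [inv_mul_eq_div, le_div_iff₀ hx'] at h <;>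
      nlinarith [sq_nonneg ‖A' x‖, sq_nonneg ‖B' x‖]
  set P : X →L[ℂ] X := A * A' + B * B' with hP
  have hin : ∀ x, inner ℂ (P x) x = ((‖A' x‖ ^ 2 + ‖B' x‖ ^ 2 : ℝ) : ℂ) := by
    intro x
    simp only [hP, add_apply, mul_apply_eq_comp, inner_add_left]
    rw [← ContinuousLinearMap.adjoint_inner_right A, ← ContinuousLinearMap.adjoint_inner_right B,
      inner_self_eq_norm_sq_to_K, inner_self_eq_norm_sq_to_K]
    push_cast; rfl
  have hunit : IsUnit P := by
    refine ContinuousLinearMap.isUnit_of_forall_le_norm_inner_map P (c := 16) (by norm_num) ?_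
    intro x
    rw [hin, Complex.norm_real, Real.norm_eq_abs, abs_of_nonneg (by positivity)]
    have := hscale x
    simp only [NNReal.coe_ofNat]
    linarith
  obtain ⟨U, hU⟩ := hunit
  set q := ((U⁻¹ : (X →L[ℂ] X)ˣ) : X →L[ℂ] X) v with hq
  have hPq : P q = v := by
    rw [← hU, hq, ← mul_apply_eq_comp, Units.mul_inv]; rfl
  have h1 : ‖A' q‖ ^ 2 + ‖B' q‖ ^ 2 ≤ ‖v‖ * ‖q‖ := by
    have h2 := norm_inner_le_norm (𝕜 := ℂ) (P q) q
    rwa [hin, Complex.norm_real, Real.norm_eq_abs, abs_of_nonneg (by positivity), hPq] at h2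
  have h2 := hscale q
  have h3 : 16 * ‖q‖ ≤ ‖v‖ := by
    by_contra hcon
    push Not at hcon
    have : 0 < ‖q‖ := by
      by_contra h0
      have := norm_nonneg v
      linarith
    nlinarith
  refine ⟨A' q, B' q, ?_, ?_, ?_⟩
  · rw [← hPq]; simp [hP]
  · refine abs_le_of_sq_le_sq' ?_ (by positivity) |>.2
    nlinarith [norm_nonneg v, sq_nonneg ‖B' q‖]
  · refine abs_le_of_sq_le_sq' ?_ (by positivity) |>.2
    nlinarith [norm_nonneg v, sq_nonneg ‖A' q‖]

lemma aux_step {X : Type*} [NormedAddCommGroup X] [NormedSpace ℂ X]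
    (T : (X →L[ℂ] X)ˣ) (n : ℕ)
    (hdec : ∀ v : X, ∃ a b : X, v = ((T ^ (n : ℤ) : (X →L[ℂ] X)ˣ) : X →L[ℂ] X) a +
      ((T ^ (-(n : ℤ)) : (X →L[ℂ] X)ˣ) : X →L[ℂ] X) b ∧ ‖a‖ ≤ ‖v‖ / 4 ∧ ‖b‖ ≤ ‖v‖ / 4) :
    ∃ C : ℝ, 0 ≤ C ∧ ∀ (M : ℝ) (z : ℤ → X), (∀ k, ‖z k‖ ≤ M) → ∃ w : ℤ → X,
      (∀ k, ‖w k‖ ≤ C * M) ∧ ∀ k, ‖z k - (w (k + 1) - (T : X →L[ℂ] X) (w k))‖ ≤ M / 2 := by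
  choose a b hab ha hb using hdec
  set t : ℤ → X →L[ℂ] X := fun k => ((T ^ k : (X →L[ℂ] X)ˣ) : X →L[ℂ] X) with ht
  refine ⟨∑ j ∈ Finset.range n, (‖t (n - 1 - j)‖ + ‖t (j - n)‖),
    Finset.sum_nonneg fun _ _ => by positivity, fun M z hz => ?_⟩
  have hM : 0 ≤ M := (norm_nonneg _).trans (hz 0)
  have hazM : ∀ k, ‖a (z k)‖ ≤ M / 4 := fun k => (ha _).trans (by linarith [hz k])
  have hbzM : ∀ k, ‖b (z k)‖ ≤ M / 4 := fun k => (hb _).trans (by linarith [hz k])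
  refine ⟨fun k => ∑ j ∈ Finset.range n,
    (t (j - n) (b (z (k - 1 - j))) - t (n - 1 - j) (a (z (k + j)))), fun k => ?_, fun k => ?_⟩
  · rw [Finset.sum_mul]
    refine norm_sum_le_of_le _ fun j _ => ?_
    refine (norm_sub_le _ _).trans ?_
    have h1 := (t (j - n)).le_opNorm (b (z (k - 1 - j)))
    have h2 := (t (n - 1 - j)).le_opNorm (a (z (k + j)))
    have h3 := hazM (k + j)
    have h4 := hbzM (k - 1 - j)
    have h5 : ‖t (j - n)‖ * ‖b (z (k - 1 - j))‖ ≤ ‖t (j - n)‖ * M :=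
      mul_le_mul_of_nonneg_left (by linarith) (norm_nonneg _)
    have h6 : ‖t (n - 1 - j)‖ * ‖a (z (k + j))‖ ≤ ‖t (n - 1 - j)‖ * M :=
      mul_le_mul_of_nonneg_left (by linarith) (norm_nonneg _)
    linarith
  · have hTt : ∀ (i m : ℤ) (x : X), m = i + 1 → (T : X →L[ℂ] X) (t i x) = t m x :=
      fun i m x hm => aux_zpow_succ T i m hm x
    let g : ℕ → X := fun j => t (n - j) (a (z (k + j)))
    let f : ℕ → X := fun j => t (j - n) (b (z (k - j)))
    have e : z k - ((∑ j ∈ Finset.range n,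
          (t (j - n) (b (z (k + 1 - 1 - j))) - t (n - 1 - j) (a (z (k + 1 + j))))) -
        (T : X →L[ℂ] X) (∑ j ∈ Finset.range n,
          (t (j - n) (b (z (k - 1 - j))) - t (n - 1 - j) (a (z (k + j)))))) =
        b (z (k - n)) + a (z (k + n)) := by
      rw [map_sum, ← Finset.sum_sub_distrib]
      have : ∀ j ∈ Finset.range n, (t (j - n) (b (z (k + 1 - 1 - j))) - t (n - 1 - j) (a (z (k + 1 + j))))
          - (T : X →L[ℂ] X) (t (j - n) (b (z (k - 1 - j))) - t (n - 1 - j) (a (z (k + j))))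
          = (f j - f (j + 1)) + (g j - g (j + 1)) := by
        intro j _
        rw [map_sub, hTt (j - n) ((j + 1 : ℕ) - n) _ (by push_cast; ring),
          hTt (n - 1 - j) (n - j) _ (by ring)]
        simp only [f, g]
        have e1 : k + 1 - 1 - (j : ℤ) = k - j := by ring
        have e2 : k - 1 - (j : ℤ) = k - (j + 1 : ℕ) := by push_cast; ring
        have e3 : k + 1 + (j : ℤ) = k + (j + 1 : ℕ) := by push_cast; ring
        have e4 : (n : ℤ) - 1 - j = n - (j + 1 : ℕ) := by push_cast; ring
        rw [e1, e2, e3, e4]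
        abel
      rw [Finset.sum_congr rfl this, Finset.sum_add_distrib, Finset.sum_range_sub',
        Finset.sum_range_sub']
      have hz' := hab (z k)
      have f0 : f 0 = t (-(n : ℤ)) (b (z k)) := by simp [f]
      have g0 : g 0 = t n (a (z k)) := by simp [g]
      have fn : f n = b (z (k - n)) := by simp [f, ht]
      have gn : g n = a (z (k + n)) := by simp [g, ht]
      rw [f0, g0, fn, gn]
      nth_rewrite 1 [hz']
      simp only [ht]
      abel
    show ‖z k - ((∑ j ∈ Finset.range n,
          (t (j - n) (b (z (k + 1 - 1 - j))) - t (n - 1 - j) (a (z (k + 1 + j))))) -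
        (T : X →L[ℂ] X) (∑ j ∈ Finset.range n,
          (t (j - n) (b (z (k - 1 - j))) - t (n - 1 - j) (a (z (k + j))))))‖ ≤ M / 2
    rw [e]
    refine (norm_add_le _ _).trans ?_
    linarith [hazM (k + n), hbzM (k - n)]

lemma aux_solve {X : Type*} [NormedAddCommGroup X] [NormedSpace ℂ X] [CompleteSpace X]
    (T : X →L[ℂ] X) (C : ℝ) 
    (hstep : ∀ (M : ℝ) (z : ℤ → X), (∀ k, ‖z k‖ ≤ M) → ∃ w : ℤ → X,
      (∀ k, ‖w k‖ ≤ C * M) ∧ ∀ k, ‖z k - (w (k + 1) - T (w k))‖ ≤ M / 2)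
    (M : ℝ) (z : ℤ → X) (hz : ∀ k, ‖z k‖ ≤ M) :
    ∃ w : ℤ → X, (∀ k, ‖w k‖ ≤ C * M * 2) ∧ ∀ k, w (k + 1) - T (w k) = z k := by
  choose! W hW1 hW2 using hstep
  let Z : ℕ → ℤ → X := fun i => Nat.rec z
    (fun i y k => y k - (W (M * (1 / 2) ^ i) y (k + 1) - T (W (M * (1 / 2) ^ i) y k))) i
  have hZ0 : Z 0 = z := rfl
  have hZs : ∀ i k, Z (i + 1) k = Z i k - (W (M * (1 / 2) ^ i) (Z i) (k + 1) -
    T (W (M * (1 / 2) ^ i) (Z i) k)) := fun i k => rfl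
  have hZ : ∀ i k, ‖Z i k‖ ≤ M * (1 / 2) ^ i := by
    intro i
    induction i with
    | zero => simpa [hZ0] using hz
    | succ i ih =>
      intro k
      rw [hZs]
      refine (hW2 _ _ ih k).trans (le_of_eq ?_)
      rw [pow_succ]; ring
  let w : ℕ → ℤ → X := fun i => W (M * (1 / 2) ^ i) (Z i)
  have hw : ∀ i k, ‖w i k‖ ≤ C * M * (1 / 2) ^ i := fun i k => by
    rw [mul_assoc]; exact hW1 _ _ (hZ i) k
  have hgeo : HasSum (fun i : ℕ => C * M * (1 / 2 : ℝ) ^ i) (C * M * 2) :=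
    hasSum_geometric_two.mul_left _
  have hsum : ∀ k, Summable fun i => w i k := fun k =>
    Summable.of_norm_bounded hgeo.summable (fun i => hw i k)
  refine ⟨fun k => ∑' i, w i k, fun k => tsum_of_norm_bounded hgeo (fun i => hw i k), fun k => ?_⟩
  have h1 : HasSum (fun i => w i (k + 1) - T (w i k)) ((∑' i, w i (k + 1)) - T (∑' i, w i k)) :=
    (hsum (k + 1)).hasSum.sub ((hsum k).hasSum.mapL T)
  have h2 := h1.tendsto_sum_nat
  have h3 : ∀ N, ∑ i ∈ Finset.range N, (w i (k + 1) - T (w i k)) = z k - Z N k := by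
    intro N
    have : ∀ i, w i (k + 1) - T (w i k) = Z i k - Z (i + 1) k := fun i => by
      rw [hZs]; simp only [w]; abel
    simp only [this]
    rw [Finset.sum_range_sub' (fun i => Z i k), hZ0]
  simp only [h3] at h2
  have h4 : Tendsto (fun N => Z N k) atTop (𝓝 0) := by
    refine squeeze_zero_norm (fun N => hZ N k) ?_
    simpa using (tendsto_pow_atTop_nhds_zero_of_lt_one (by norm_num : (0 : ℝ) ≤ 1 / 2)
      (by norm_num)).const_mul M
  have h5 : Tendsto (fun N => z k - Z N k) atTop (𝓝 (z k)) := by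
    simpa using h4.const_sub (z k)
  exact tendsto_nhds_unique h2 h5

lemma aux_shadow {X : Type*} [NormedAddCommGroup X] [NormedSpace ℂ X]
    (T : (X →L[ℂ] X)ˣ) (C : ℝ) (hC : 0 ≤ C)
    (hs : ∀ (M : ℝ) (z : ℤ → X), (∀ k, ‖z k‖ ≤ M) →
    ∃ w : ℤ → X, (∀ k, ‖w k‖ ≤ C * M * 2) ∧ ∀ k, w (k + 1) - (T : X →L[ℂ] X) (w k) = z k) :
    ShadowingProperty T := by
  intro ε hε
  refine ⟨ε / (2 * C + 1), by positivity, fun x hx => ?_⟩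
  obtain ⟨w, hw1, hw2⟩ := hs _ _ hx
  have hu : ∀ k, x (k + 1) - w (k + 1) = (T : X →L[ℂ] X) (x k - w k) := by
    intro k
    rw [map_sub]
    have := hw2 k
    rw [sub_eq_sub_iff_add_eq_add] at this ⊢
    rw [← this, add_comm]
  have horb : ∀ k : ℤ, x k - w k = ((T ^ k : (X →L[ℂ] X)ˣ) : X →L[ℂ] X) (x 0 - w 0) := by
    intro k
    induction k using Int.induction_on with
    | zero => simp
    | succ i ih => rw [hu, ih]; exact aux_zpow_succ T _ _ rfl _
    | pred i ih =>
      have h1 := hu (-(i : ℤ) - 1)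
      rw [sub_add_cancel, ih] at h1
      have h2 := congrArg (((T ^ (-1 : ℤ) : (X →L[ℂ] X)ˣ) : X →L[ℂ] X)) h1
      rw [← aux_zpow_add] at h2
      have h3 : ∀ y, (T : X →L[ℂ] X) y = ((T ^ (1 : ℤ) : (X →L[ℂ] X)ˣ) : X →L[ℂ] X) y := by simp
      rw [h3, ← aux_zpow_add] at h2
      rw [show (-1 : ℤ) + 1 = 0 by norm_num, aux_zpow_zero] at h2
      rw [← h2]; congr 3; ring
  refine ⟨x 0 - w 0, fun k => ?_⟩
  rw [← horb, sub_sub_cancel]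
  refine (hw1 k).trans ?_
  rw [mul_div_assoc', div_mul_eq_mul_div, div_le_iff₀ (by positivity)]
  nlinarith

lemma aux_C_A {X : Type*} [NormedAddCommGroup X] [InnerProductSpace ℂ X] [CompleteSpace X]
    (T : (X →L[ℂ] X)ˣ) 
    (h : ∀ l : ℂ, ‖l‖ = 1 → ∃ α > (0 : ℝ), ∀ x : X,
      α * ‖x‖ ≤ ‖l • x - ((star T : (X →L[ℂ] X)ˣ) : X →L[ℂ] X) x‖) :
    ShadowingProperty T := by
  obtain ⟨n, hn, hexp⟩ := aux_C_B (star T) h 4 (by norm_num)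
  obtain ⟨C, hC, hstep⟩ := aux_step T n (aux_dec _ _ (fun x hx => by
    have := hexp x hx
    rwa [← star_zpow, ← star_zpow, Units.coe_star, Units.coe_star,
      ContinuousLinearMap.star_eq_adjoint, ContinuousLinearMap.star_eq_adjoint] at this))
  exact aux_shadow T C hC (fun M z hz => aux_solve _ C hstep M z hz)

end helpers

/-- An invertible operator `T` on a complex Hilbert space has the shadowing property if
and only if its adjoint `T*` is uniformly expansive; equivalently, if and only if the
approximate point spectrum of `T*` is disjoint from the unit circle. -/
theorem shadowing_iff_adjoint_uniformlyExpansive (T Tstar : (X →L[ℂ] X)ˣ)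
    (h : (Tstar : X →L[ℂ] X) = ContinuousLinearMap.adjoint (T : X →L[ℂ] X)) :
    (ShadowingProperty T ↔ UniformlyExpansive Tstar) ∧
    (ShadowingProperty T ↔
      ApproxPointSpectrum (ContinuousLinearMap.adjoint (T : X →L[ℂ] X)) ∩
        {l : ℂ | ‖l‖ = 1} = ∅) := by
  have hT : Tstar = star T := Units.ext (by
    rw [h, Units.coe_star, ContinuousLinearMap.star_eq_adjoint])
  have hCiff : ApproxPointSpectrum (ContinuousLinearMap.adjoint (T : X →L[ℂ] X)) ∩
        {l : ℂ | ‖l‖ = 1} = ∅ ↔ ∀ l : ℂ, ‖l‖ = 1 → ∃ α > (0 : ℝ), ∀ x : X, α * ‖x‖ ≤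
      ‖(l • (1 : X →L[ℂ] X) - ContinuousLinearMap.adjoint (T : X →L[ℂ] X)) x‖ := by
    rw [Set.eq_empty_iff_forall_notMem]
    constructor
    · intro hh l hl
      by_contra hcon
      exact hh l ⟨hcon, hl⟩
    · rintro hh l ⟨h1, h2⟩
      exact h1 (hh l h2)
  rw [hCiff]
  have hC : ∀ (hc : ∀ l : ℂ, ‖l‖ = 1 → ∃ α > (0 : ℝ), ∀ x : X, α * ‖x‖ ≤
      ‖(l • (1 : X →L[ℂ] X) - ContinuousLinearMap.adjoint (T : X →L[ℂ] X)) x‖),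
      ∀ l : ℂ, ‖l‖ = 1 → ∃ α > (0 : ℝ), ∀ x : X,
      α * ‖x‖ ≤ ‖l • x - (Tstar : X →L[ℂ] X) x‖ := by
    intro hc l hl
    obtain ⟨α, h1, h2⟩ := hc l hl
    exact ⟨α, h1, fun x => by simpa [h] using h2 x⟩
  refine ⟨⟨fun hA => aux_C_B Tstar (hC (aux_A_C T hA)) 2 (by norm_num), fun hB => ?_⟩,
    ⟨fun hA => aux_A_C T hA, fun hc => ?_⟩⟩
  · refine aux_C_A T ?_
    rw [← hT]
    refine hC fun l hl => ?_
    rw [← h]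
    exact aux_B_C Tstar hB l hl
  · refine aux_C_A T ?_
    rw [← hT]
    exact hC hc
end
end

section
/- Let X be a complex Banach space and let T be an invertible bounded linear operator on X. Then T is uniformly expansive if and only if the approximate point spectrum of T is disjoint from the unit circle: σ_a(T) ∩ 𝕋 = ∅. -/
open Filter Topology

noncomputable section

variable {X : Type*} [NormedAddCommGroup X] [NormedSpace ℂ X] [CompleteSpace X]

lemma ue_homog (T : (X →L[ℂ] X)ˣ) (A B : X →L[ℂ] X)
    (h : ∀ x : X, ‖x‖ = 1 → 2 ≤ ‖A x‖ ∨ 2 ≤ ‖B x‖) (x : X) :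
    2 * ‖x‖ ≤ ‖A x‖ ∨ 2 * ‖x‖ ≤ ‖B x‖ := by
  by_cases hx : x = 0
  · left; simp [hx]
  have hp : 0 < ‖x‖ := norm_pos_iff.mpr hx
  have h1 : ‖((‖x‖⁻¹ : ℝ) : ℂ) • x‖ = 1 := by
    rw [norm_smul, Complex.norm_real, norm_inv, norm_norm, inv_mul_cancel₀ hp.ne']
  have key : ∀ C : X →L[ℂ] X, 2 ≤ ‖C (((‖x‖⁻¹ : ℝ) : ℂ) • x)‖ → 2 * ‖x‖ ≤ ‖C x‖ := by
    intro C hC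
    rw [map_smul, norm_smul, Complex.norm_real, norm_inv, norm_norm, inv_mul_eq_div,
      le_div_iff₀ hp] at hC
    exact hC
  exact (h _ h1).imp (key A) (key B)

lemma geom_fact (A : X →L[ℂ] X) (l : ℂ) (n : ℕ) :
    (l • (1 : X →L[ℂ] X) - A) * (∑ i ∈ Finset.range n, l ^ i • A ^ (n - 1 - i))
      = l ^ n • (1 : X →L[ℂ] X) - A ^ n ∧
    (∑ i ∈ Finset.range n, l ^ i • A ^ (n - 1 - i)) * (l • (1 : X →L[ℂ] X) - A)
      = l ^ n • (1 : X →L[ℂ] X) - A ^ n := by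
  have hc : Commute (l • (1 : X →L[ℂ] X)) A := (Commute.one_left A).smul_left l
  have h1 := hc.mul_geom_sum₂ n
  have h2 := hc.geom_sum₂_mul n
  simp only [smul_pow, one_pow, smul_mul_assoc, one_mul] at h1 h2
  exact ⟨h1, h2⟩

lemma forward_dir (T : (X →L[ℂ] X)ˣ) (h : UniformlyExpansive T) (l : ℂ) (hl : ‖l‖ = 1) :
    ∃ α > (0 : ℝ), ∀ x : X, α * ‖x‖ ≤ ‖(l • (1 : X →L[ℂ] X) - (T : X →L[ℂ] X)) x‖ := by
  obtain ⟨n, hn, h⟩ := h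
  set P := ∑ i ∈ Finset.range n, l ^ i • (T : X →L[ℂ] X) ^ (n - 1 - i) with hP
  have hg := (geom_fact (T : X →L[ℂ] X) l n).2
  rw [← hP] at hg
  set A := ((T ^ (n : ℤ) : (X →L[ℂ] X)ˣ) : X →L[ℂ] X) with hA
  set B := ((T ^ (-(n : ℤ)) : (X →L[ℂ] X)ˣ) : X →L[ℂ] X) with hB
  have hAT : A = (T : X →L[ℂ] X) ^ n := by simp [hA]
  have hBA : B * A = 1 := by
    rw [hA, hB, ← Units.val_mul, ← zpow_add]; simp
  rw [← hAT] at hg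
  have hln : ‖l ^ n‖ = 1 := by simp [hl]
  refine ⟨((1 + ‖B‖) * ‖P‖ + 1)⁻¹, by positivity, fun x => ?_⟩
  set d := (l • (1 : X →L[ℂ] X) - (T : X →L[ℂ] X)) x with hd
  have hPd : P d = l ^ n • x - A x := by
    have := congrArg (fun f : X →L[ℂ] X => f x) hg
    simpa [hd] using this
  have hPn : ‖P d‖ ≤ ‖P‖ * ‖d‖ := P.le_opNorm d
  have hAx : ‖A x‖ ≤ ‖x‖ + ‖P‖ * ‖d‖ := by
    have e : A x = l ^ n • x - P d := by rw [hPd]; abel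
    rw [e]
    calc _ ≤ ‖l ^ n • x‖ + ‖P d‖ := norm_sub_le _ _
      _ ≤ _ := by rw [norm_smul, hln, one_mul]; linarith
  have hBx : ‖B x‖ ≤ ‖x‖ + ‖B‖ * (‖P‖ * ‖d‖) := by
    have e : l ^ n • B x = x + B (P d) := by
      have e2 : B (A x) = x := by
        have := congrArg (fun f : X →L[ℂ] X => f x) hBA
        simpa using this
      rw [hPd, map_sub, map_smul, e2]; abel
    have e3 : ‖B x‖ = ‖l ^ n • B x‖ := by rw [norm_smul, hln, one_mul]
    rw [e3, e]
    calc _ ≤ ‖x‖ + ‖B (P d)‖ := norm_add_le _ _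
      _ ≤ _ := by
        have := B.le_opNorm (P d)
        have := mul_le_mul_of_nonneg_left hPn (norm_nonneg B)
        linarith
  rw [inv_mul_le_iff₀ (by positivity)]
  have p1 : 0 ≤ ‖P‖ * ‖d‖ := by positivity
  have p2 : 0 ≤ ‖B‖ * (‖P‖ * ‖d‖) := by positivity
  have p3 := norm_nonneg d
  rcases ue_homog T A B h x with h' | h' <;> nlinarith

lemma uniform_alpha (A : X →L[ℂ] X)
    (h : ∀ l : ℂ, ‖l‖ = 1 → ∃ α > (0 : ℝ), ∀ x : X, α * ‖x‖ ≤ ‖(l • (1 : X →L[ℂ] X) - A) x‖) :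
    ∃ α > (0 : ℝ), ∀ l : ℂ, ‖l‖ = 1 → ∀ x : X, α * ‖x‖ ≤ ‖(l • (1 : X →L[ℂ] X) - A) x‖ := by
  have hc : IsCompact (Metric.sphere (0 : ℂ) 1) := isCompact_sphere _ _
  have := hc.induction_on (p := fun s => ∃ α > (0 : ℝ), ∀ l ∈ s, ∀ x : X,
    α * ‖x‖ ≤ ‖(l • (1 : X →L[ℂ] X) - A) x‖) ⟨1, one_pos, by simp⟩
    (fun s t hst ⟨α, h0, h1⟩ => ⟨α, h0, fun l hl => h1 l (hst hl)⟩)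
    (fun s t ⟨α, h0, h1⟩ ⟨β, k0, k1⟩ => ⟨min α β, lt_min h0 k0, fun l hl x => by
      rcases hl with hl | hl
      · exact (mul_le_mul_of_nonneg_right (min_le_left _ _) (norm_nonneg x)).trans (h1 l hl x)
      · exact (mul_le_mul_of_nonneg_right (min_le_right _ _) (norm_nonneg x)).trans (k1 l hl x)⟩)
    (fun l hl => by
      obtain ⟨α, h0, h1⟩ := h l (by simpa using hl)
      refine ⟨Metric.ball l (α / 2), mem_nhdsWithin_of_mem_nhds (Metric.ball_mem_nhds _ (by positivity)),
        α / 2, by positivity, fun m hm x => ?_⟩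
      have e : (l • (1 : X →L[ℂ] X) - A) x = (m • (1 : X →L[ℂ] X) - A) x - (m - l) • x := by
        simp [sub_smul]
      have h2 := h1 x
      rw [e] at h2
      have h3 := norm_sub_le ((m • (1 : X →L[ℂ] X) - A) x) ((m - l) • x)
      rw [norm_smul] at h3
      have h4 : ‖m - l‖ ≤ α / 2 := by rw [← dist_eq_norm]; exact (Metric.mem_ball.mp hm).le
      have h5 := mul_le_mul_of_nonneg_right h4 (norm_nonneg x)
      linarith)
  obtain ⟨α, h0, h1⟩ := this
  exact ⟨α, h0, fun l hl => h1 l (by simpa using hl)⟩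

lemma root_sum (n : ℕ) (hn : 0 < n) (z : ℂ) (hz : IsPrimitiveRoot z n) (m : ℕ) :
    ∑ r ∈ Finset.range n, (z ^ r) ^ m = if n ∣ m then (n : ℂ) else 0 := by
  have e : ∀ r, (z ^ r) ^ m = (z ^ m) ^ r := fun r => by rw [← pow_mul, ← pow_mul, mul_comm]
  simp only [e]
  split_ifs with hd
  · rw [(hz.pow_eq_one_iff_dvd m).mpr hd]; simp
  · have hne : z ^ m ≠ 1 := fun h => hd ((hz.pow_eq_one_iff_dvd m).mp h)
    have := mul_geom_sum (z ^ m) n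
    rw [← pow_mul, mul_comm m n, pow_mul, hz.pow_eq_one, one_pow, sub_self] at this
    exact (mul_eq_zero.mp this).resolve_left (sub_ne_zero.mpr hne)

lemma fejer_sum (A : X →L[ℂ] X) (n : ℕ) (hn : 0 < n) (z : ℂ) (hz : IsPrimitiveRoot z n) :
    ∑ r ∈ Finset.range n, z ^ r • ((∑ i ∈ Finset.range n, (z ^ r) ^ i • A ^ (n - 1 - i)) *
      (∑ i ∈ Finset.range n, (z ^ r) ^ i • A ^ (n - 1 - i))) = ((n : ℂ) * n) • A ^ (n - 1) := by
  have e : ∀ r, z ^ r • ((∑ i ∈ Finset.range n, (z ^ r) ^ i • A ^ (n - 1 - i)) *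
      (∑ i ∈ Finset.range n, (z ^ r) ^ i • A ^ (n - 1 - i))) =
      ∑ i ∈ Finset.range n, ∑ j ∈ Finset.range n, (z ^ r) ^ (i + j + 1) •
        A ^ ((n - 1 - i) + (n - 1 - j)) := by
    intro r
    rw [Finset.sum_mul_sum, Finset.smul_sum]
    refine Finset.sum_congr rfl fun i _ => ?_
    rw [Finset.smul_sum]
    refine Finset.sum_congr rfl fun j _ => ?_
    rw [smul_mul_smul_comm, smul_smul, ← pow_add, ← pow_add, pow_succ' (z ^ r)]
  simp only [e]
  rw [Finset.sum_comm]
  have inner : ∀ i ∈ Finset.range n, ∑ r ∈ Finset.range n, ∑ j ∈ Finset.range n,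
      (z ^ r) ^ (i + j + 1) • A ^ ((n - 1 - i) + (n - 1 - j)) = (n : ℂ) • A ^ (n - 1) := by
    intro i hi
    rw [Finset.mem_range] at hi
    rw [Finset.sum_comm]
    simp only [← Finset.sum_smul, root_sum n hn z hz]
    rw [Finset.sum_eq_single (n - 1 - i)]
    · have h1 : i + (n - 1 - i) + 1 = n := by omega
      have h2 : n - 1 - i + (n - 1 - (n - 1 - i)) = n - 1 := by omega
      rw [h1, h2]; simp
    · intro j hj hne
      rw [Finset.mem_range] at hj
      rw [if_neg, zero_smul]
      rintro ⟨c, hc⟩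
      have hc1 : c < 2 := by
        by_contra hh
        have : n * 2 ≤ n * c := Nat.mul_le_mul_left n (by omega)
        omega
      interval_cases c <;> omega
    · intro hh; exact absurd (Finset.mem_range.mpr (by omega)) hh
  rw [Finset.sum_congr rfl inner]
  simp [mul_smul, Nat.cast_smul_eq_nsmul]

lemma main_bound (A : X →L[ℂ] X) (α : ℝ) (h0 : 0 < α)
    (h : ∀ l : ℂ, ‖l‖ = 1 → ∀ x : X, α * ‖x‖ ≤ ‖(l • (1 : X →L[ℂ] X) - A) x‖)
    (n : ℕ) (hn : 0 < n) (y : X) :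
    n * (α ^ 2 * ‖(A ^ (n - 1)) y‖) ≤ ‖y‖ + 2 * ‖(A ^ n) y‖ + ‖(A ^ n) ((A ^ n) y)‖ := by
  obtain ⟨z, hz⟩ : ∃ z : ℂ, IsPrimitiveRoot z n := ⟨_, Complex.isPrimitiveRoot_exp n hn.ne'⟩
  set R := ‖y‖ + 2 * ‖(A ^ n) y‖ + ‖(A ^ n) ((A ^ n) y)‖ with hR
  have hz1 : ‖z‖ = 1 := hz.norm'_eq_one hn.ne'
  have hf := congrArg (fun f : X →L[ℂ] X => f y) (fejer_sum A n hn z hz)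
  have hb : ∀ r ∈ Finset.range n, ‖(z ^ r • ((∑ i ∈ Finset.range n, (z ^ r) ^ i • A ^ (n - 1 - i)) *
      (∑ i ∈ Finset.range n, (z ^ r) ^ i • A ^ (n - 1 - i)))) y‖ ≤ R / α ^ 2 := by
    intro r _
    have hr : ‖z ^ r‖ = 1 := by simp [hz1]
    have hrn : (z ^ r) ^ n = 1 := by rw [← pow_mul, mul_comm, pow_mul, hz.pow_eq_one, one_pow]
    obtain ⟨g1, g2⟩ := geom_fact A (z ^ r) n
    rw [hrn, one_smul] at g1 g2
    set S := ∑ i ∈ Finset.range n, (z ^ r) ^ i • A ^ (n - 1 - i)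
    set D := (z ^ r) • (1 : X →L[ℂ] X) - A with hD
    have hDS : D * (D * (S * S)) = (1 - A ^ n) * (1 - A ^ n) := by
      calc D * (D * (S * S)) = D * ((D * S) * S) := by rw [mul_assoc D S S]
        _ = D * ((S * D) * S) := by rw [g1, g2]
        _ = (D * S) * (D * S) := by simp only [mul_assoc]
        _ = _ := by rw [g1]
    have hDy := congrArg (fun f : X →L[ℂ] X => f y) hDS
    have e : ‖D (D ((S * S) y))‖ ≤ R := by
      have : D (D ((S * S) y)) = (y - (A ^ n) y) - ((A ^ n) y - (A ^ n) ((A ^ n) y)) := by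
        simpa only [ContinuousLinearMap.mul_apply', ContinuousLinearMap.mul_def, ContinuousLinearMap.comp_apply,
          ContinuousLinearMap.sub_apply, ContinuousLinearMap.one_apply, map_sub] using hDy
      rw [this]
      have := norm_sub_le (y - (A ^ n) y) ((A ^ n) y - (A ^ n) ((A ^ n) y))
      have := norm_sub_le y ((A ^ n) y)
      have := norm_sub_le ((A ^ n) y) ((A ^ n) ((A ^ n) y))
      linarith
    rw [ContinuousLinearMap.smul_apply, norm_smul, hr, one_mul, le_div_iff₀ (by positivity)]
    have k1 := h (z ^ r) hr ((S * S) y)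
    have k2 := h (z ^ r) hr (D ((S * S) y))
    rw [← hD] at k1 k2
    have k3 := mul_le_mul_of_nonneg_left k1 h0.le
    nlinarith
  have hs := norm_sum_le_of_le _ hb
  rw [← ContinuousLinearMap.sum_apply] at hs
  rw [hf, ContinuousLinearMap.smul_apply, norm_smul] at hs
  simp only [norm_mul, Complex.norm_natCast, Finset.sum_const, Finset.card_range, nsmul_eq_mul] at hs
  have hn' : (0 : ℝ) < n := by exact_mod_cast hn
  rw [mul_assoc] at hs
  have := le_of_mul_le_mul_left hs hn'
  rw [le_div_iff₀ (by positivity)] at this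
  linarith

theorem uniformlyExpansive_iff_approxPointSpectrum_disjoint_unitCircle
    (T : (X →L[ℂ] X)ˣ) :
    UniformlyExpansive T ↔
      ApproxPointSpectrum (T : X →L[ℂ] X) ∩ {l : ℂ | ‖l‖ = 1} = ∅ := by
  constructor
  · intro h
    ext l
    simp only [Set.mem_inter_iff, Set.mem_setOf_eq, Set.mem_empty_iff_false, iff_false, not_and]
    intro h1 hl
    exact h1 (forward_dir T h l hl)
  · intro h
    obtain ⟨α, h0, hα⟩ := uniform_alpha (T : X →L[ℂ] X) (fun l hl => by
      by_contra hc
      have : l ∈ ApproxPointSpectrum (T : X →L[ℂ] X) ∩ {l : ℂ | ‖l‖ = 1} := ⟨hc, hl⟩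
      rw [h] at this
      exact this)
    obtain ⟨n, hn⟩ := exists_nat_gt (6 * ‖(T : X →L[ℂ] X)‖ / α ^ 2)
    have hnpos : 0 < n := by
      have : (0 : ℝ) < n := lt_of_le_of_lt (by positivity) hn
      exact_mod_cast this
    refine ⟨n, hnpos, fun x hx => ?_⟩
    by_contra hc
    push Not at hc
    obtain ⟨c1, c2⟩ := hc
    set y := ((T ^ (-(n : ℤ)) : (X →L[ℂ] X)ˣ) : X →L[ℂ] X) x with hy
    have hAT : ((T ^ (n : ℤ) : (X →L[ℂ] X)ˣ) : X →L[ℂ] X) = (T : X →L[ℂ] X) ^ n := by simp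
    rw [hAT] at c1
    have hAy : ((T : X →L[ℂ] X) ^ n) y = x := by
      have e : ((T ^ (n : ℤ) : (X →L[ℂ] X)ˣ) : X →L[ℂ] X) *
          ((T ^ (-(n : ℤ)) : (X →L[ℂ] X)ˣ) : X →L[ℂ] X) = 1 := by
        rw [← Units.val_mul, ← zpow_add]; simp
      rw [hAT] at e
      have := congrArg (fun f : X →L[ℂ] X => f x) e
      exact this
    have hb := main_bound (T : X →L[ℂ] X) α h0 hα n hnpos y
    rw [hAy, hx] at hb
    have hx2 : (T : X →L[ℂ] X) (((T : X →L[ℂ] X) ^ (n - 1)) y) = x := by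
      rw [← hAy]
      conv_rhs => rw [← Nat.sub_add_cancel hnpos, pow_succ']
      rfl
    have hle := (T : X →L[ℂ] X).le_opNorm (((T : X →L[ℂ] X) ^ (n - 1)) y)
    rw [hx2, hx] at hle
    rw [div_lt_iff₀ (by positivity)] at hn
    set w := ‖((T : X →L[ℂ] X) ^ (n - 1)) y‖
    have hw : 0 ≤ w := norm_nonneg _
    have hwpos : 0 < w := by
      rcases hw.lt_or_eq with h | h
      · exact h
      · rw [← h] at hle; norm_num at hle
    have := mul_lt_mul_of_pos_right hn hwpos
    nlinarith
end
end

section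
/- Let X = ℓ²(ℤ, ℂ) with orthonormal basis (e_n)_{n∈ℤ}, and let T be the bilateral weighted forward shift determined by T e_n = 2√2 · e_{n+1} for n ≥ 0 and T e_n = (1/(2√2)) · e_{n+1} for n ≤ −1. Then T is an invertible bounded linear operator that is uniformly expansive, but T does not have the shadowing property and T is not hyperbolic. -/
open Filter Topology

noncomputable section

/-- An invertible operator `T` is hyperbolic if `X = M ⊕ N` for closed `T`-invariant
subspaces with the restrictions of `T` to `M` and of `T⁻¹` to `N` of spectral radius
less than one. -/
def Hyperbolic {Y : Type*} [NormedAddCommGroup Y] [NormedSpace ℂ Y]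
    (T : (Y →L[ℂ] Y)ˣ) : Prop :=
  ∃ M N : Submodule ℂ Y, IsClosed (M : Set Y) ∧ IsClosed (N : Set Y) ∧ IsCompl M N ∧
    Submodule.map ((T : Y →L[ℂ] Y) : Y →ₗ[ℂ] Y) M = M ∧
    Submodule.map ((T : Y →L[ℂ] Y) : Y →ₗ[ℂ] Y) N = N ∧
    ∃ (A : M →L[ℂ] M) (B : N →L[ℂ] N),
      (∀ m : M, (A m : Y) = (T : Y →L[ℂ] Y) (m : Y)) ∧
      (∀ v : N, (B v : Y) = ((T⁻¹ : (Y →L[ℂ] Y)ˣ) : Y →L[ℂ] Y) (v : Y)) ∧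
      spectralRadius ℂ A < 1 ∧ spectralRadius ℂ B < 1

/-- The standard orthonormal basis vectors of `ℓ²(ℤ, ℂ)`. -/
def e (n : ℤ) : lp (fun _ : ℤ => ℂ) 2 := lp.single 2 n 1

abbrev HH := lp (fun _ : ℤ => ℂ) 2

def cc : ℝ := 2 * Real.sqrt 2

def ww (n : ℤ) : ℝ := if 0 ≤ n then cc else cc⁻¹

lemma cc_sq : cc ^ 2 = 8 := by
  unfold cc; rw [mul_pow, Real.sq_sqrt (by norm_num)]; norm_num

lemma cc_pos : 0 < cc := by unfold cc; positivity

lemma one_lt_cc : 1 < cc := by nlinarith [cc_sq, cc_pos]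

lemma ww_pos (n : ℤ) : 0 < ww n := by
  have := cc_pos
  unfold ww; split_ifs <;> positivity

lemma ww_inv_le (n : ℤ) : (ww n)⁻¹ ≤ cc := by
  have := one_lt_cc
  unfold ww; split_ifs
  · exact (inv_le_one_of_one_le₀ this.le).trans this.le
  · simp

lemma e_self (n : ℤ) : (e n : HH) n = 1 := by
  simp [e]

lemma e_ne (n m : ℤ) (h : m ≠ n) : (e n : HH) m = 0 := by
  simp [e, Pi.single_apply, h]

lemma norm_e (n : ℤ) : ‖e n‖ = 1 := by
  simp [e]

lemma coordT (T : HH →L[ℂ] HH) (hT : ∀ n, T (e n) = ((ww n : ℝ) : ℂ) • e (n + 1))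
    (x : HH) (n : ℤ) : T x (n + 1) = (ww n : ℂ) * x n := by
  have h1 := lp.hasSum_single (E := fun _ : ℤ => ℂ) (p := 2) (by norm_num) x
  have h2 := (h1.mapL T).mapL (lp.evalCLM ℂ (fun _ : ℤ => ℂ) 2 (n + 1))
  have h3 : ∀ i, lp.evalCLM ℂ (fun _ : ℤ => ℂ) 2 (n + 1) (T (lp.single 2 i (x i)))
      = if i = n then (ww n : ℂ) * x n else 0 := by
    intro i
    have : (lp.single 2 i (x i) : HH) = x i • e i := by
      unfold e; rw [← lp.single_smul]; simp
    rw [this, map_smul, hT]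
    change (x i • (((ww i : ℝ) : ℂ) • e (i + 1)) : HH) (n + 1) = _
    rw [lp.coeFn_smul, Pi.smul_apply, lp.coeFn_smul, Pi.smul_apply]
    split_ifs with h
    · subst h; rw [e_self]; simp [mul_comm]
    · rw [e_ne _ _ (by omega)]; simp
  simp_rw [h3] at h2
  exact h2.unique (hasSum_ite_eq n _)

lemma injT (T : HH →L[ℂ] HH) (hT : ∀ (x : HH) (n : ℤ), T x (n + 1) = (ww n : ℂ) * x n) :
    Function.Injective T := by
  rw [injective_iff_map_eq_zero]
  intro x hx
  ext n
  have := hT x n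
  rw [hx] at this
  have h2 : (ww n : ℂ) ≠ 0 := by exact_mod_cast (ww_pos n).ne'
  simpa [h2] using this.symm

lemma surjT (T : HH →L[ℂ] HH) (hT : ∀ (x : HH) (n : ℤ), T x (n + 1) = (ww n : ℂ) * x n) :
    Function.Surjective T := by
  intro y
  have hy : Summable fun n : ℤ => ‖y n‖ ^ (2 : ℝ) := by
    have := lp.memℓp y
    rw [memℓp_gen_iff (by norm_num)] at this
    simpa using this
  have hm : Memℓp (E := fun _ : ℤ => ℂ) (fun n => (ww n : ℂ)⁻¹ * y (n + 1)) 2 := by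
    rw [memℓp_gen_iff (by norm_num)]
    have h1 := (hy.comp_injective (add_left_injective (1 : ℤ))).mul_left (cc ^ 2)
    refine Summable.of_nonneg_of_le (fun n => by positivity) (fun n => ?_) h1
    have := ww_inv_le n
    have := ww_pos n
    simp only [ENNReal.toReal_ofNat, Real.rpow_ofNat, norm_mul, norm_inv, mul_pow,
      Function.comp, Complex.norm_real, Real.norm_eq_abs, abs_of_pos (ww_pos n)]
    gcongr
  refine ⟨⟨_, hm⟩, ?_⟩
  ext k
  obtain ⟨n, rfl⟩ : ∃ n, k = n + 1 := ⟨k - 1, by ring⟩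
  rw [hT]
  have h2 : (ww n : ℂ) ≠ 0 := by exact_mod_cast (ww_pos n).ne'
  change (ww n : ℂ) * ((ww n : ℂ)⁻¹ * y (n + 1)) = _
  field_simp

def HC (U : (HH →L[ℂ] HH)ˣ) : Prop :=
  ∀ (x : HH) (n : ℤ), (U : HH →L[ℂ] HH) x (n + 1) = (ww n : ℂ) * x n

lemma inv_coord (U : (HH →L[ℂ] HH)ˣ) (hU : HC U) (x : HH) (n : ℤ) :
    ((U⁻¹ : (HH →L[ℂ] HH)ˣ) : HH →L[ℂ] HH) x n = (ww n : ℂ)⁻¹ * x (n + 1) := by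
  have h := hU (((U⁻¹ : (HH →L[ℂ] HH)ˣ) : HH →L[ℂ] HH) x) n
  have h1 : (U : HH →L[ℂ] HH) (((U⁻¹ : (HH →L[ℂ] HH)ˣ) : HH →L[ℂ] HH) x) = x := by
    rw [← mul_apply_eq_comp, Units.mul_inv]; rfl
  rw [h1] at h
  have h2 : (ww n : ℂ) ≠ 0 := by exact_mod_cast (ww_pos n).ne'
  rw [h]; field_simp

lemma pow_coord (U : (HH →L[ℂ] HH)ˣ) (hU : HC U) (x : HH) (n : ℕ) :
    ((U : HH →L[ℂ] HH) ^ n) x (n : ℤ) = (cc : ℂ) ^ n * x 0 := by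
  induction n with
  | zero => simp
  | succ n ih =>
    rw [pow_succ', mul_apply_eq_comp]
    rw [Nat.cast_succ, hU, ih, ww, if_pos (by positivity)]; ring

lemma pow_inv_coord (U : (HH →L[ℂ] HH)ˣ) (hU : HC U) (x : HH) (n : ℕ) :
    (((U⁻¹ : (HH →L[ℂ] HH)ˣ) : HH →L[ℂ] HH) ^ n) x (-(n : ℤ)) = (cc : ℂ) ^ n * x 0 := by
  induction n with
  | zero => simp
  | succ n ih =>
    rw [pow_succ', mul_apply_eq_comp]
    rw [Nat.cast_succ, inv_coord U hU, show -((n : ℤ) + 1) + 1 = -(n : ℤ) by ring, ih, ww, if_neg (by omega)]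
    push_cast
    rw [inv_inv]; ring

lemma growth (a : ℂ) (C : ℝ) (f : ℕ → HH) (k : ℕ → ℤ) (hf : ∀ n, f n (k n) = (cc : ℂ) ^ n * a)
    (hC : ∀ᶠ n in atTop, ‖f n‖ ≤ C) : a = 0 := by
  by_contra ha
  have h1 : Tendsto (fun n : ℕ => cc ^ n * ‖a‖) atTop atTop :=
    (tendsto_pow_atTop_atTop_of_one_lt one_lt_cc).atTop_mul_const (norm_pos_iff.2 ha)
  obtain ⟨n, h2, h3⟩ := ((h1.eventually_gt_atTop C).and hC).exists
  have h4 := lp.norm_apply_le_norm (by norm_num : (2 : ENNReal) ≠ 0) (f n) (k n)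
  rw [hf, norm_mul, norm_pow, Complex.norm_real, Real.norm_of_nonneg cc_pos.le] at h4
  linarith

lemma sr_bdd {A : Type*} [NormedRing A] [NormedAlgebra ℂ A] [CompleteSpace A] (a : A)
    (h : spectralRadius ℂ a < 1) : ∀ᶠ n : ℕ in atTop, ‖a ^ n‖ ≤ 1 := by
  have h1 := spectrum.pow_nnnorm_pow_one_div_tendsto_nhds_spectralRadius a
  filter_upwards [h1.eventually_lt_const h, eventually_gt_atTop 0] with n hn h0
  by_contra! hc
  have : (1 : ENNReal) ≤ ‖a ^ n‖₊ := by exact_mod_cast hc.le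
  exact absurd (ENNReal.one_le_rpow this (by positivity)) (not_le.2 hn)

lemma restr_bdd (S : HH →L[ℂ] HH) (M : Submodule ℂ HH) (hM : IsClosed (M : Set HH))
    (A : M →L[ℂ] M) (hA : ∀ m : M, (A m : HH) = S m) (h : spectralRadius ℂ A < 1) (m : M) :
    ∀ᶠ n : ℕ in atTop, ‖(S ^ n) (m : HH)‖ ≤ ‖m‖ := by
  haveI : CompleteSpace M := hM.completeSpace_coe
  filter_upwards [sr_bdd A h] with n hn
  have key : ((A ^ n) m : HH) = (S ^ n) (m : HH) := by
    clear hn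
    induction n with
    | zero => simp
    | succ n ih => rw [pow_succ', pow_succ', mul_apply_eq_comp,
        mul_apply_eq_comp, hA, ih]
  rw [← key]
  calc ‖(A ^ n) m‖ ≤ ‖A ^ n‖ * ‖m‖ := (A ^ n).le_opNorm m
    _ ≤ 1 * ‖m‖ := by gcongr
    _ = _ := one_mul _

lemma not_hyp (U : (HH →L[ℂ] HH)ˣ) (hU : HC U) : ¬ Hyperbolic U := by
  rintro ⟨M, N, hM, hN, hc, -, -, A, B, hA, hB, rA, rB⟩
  have h1 : (e 0 : HH) ∈ M ⊔ N := by rw [hc.sup_eq_top]; trivial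
  obtain ⟨m, hm, v, hv, hmv⟩ := Submodule.mem_sup.1 h1
  have hm0 : m 0 = 0 := growth _ _ _ (fun n => (n : ℤ)) (pow_coord U hU m)
    (restr_bdd _ M hM A hA rA ⟨m, hm⟩)
  have hv0 : v 0 = 0 := growth _ _ _ (fun n => -(n : ℤ)) (pow_inv_coord U hU v)
    (restr_bdd _ N hN B hB rB ⟨v, hv⟩)
  have : (e 0 : HH) 0 = m 0 + v 0 := by rw [← hmv]; rfl
  rw [e_self, hm0, hv0] at this
  simp at this

lemma not_shad (U : (HH →L[ℂ] HH)ˣ) (hU : HC U) : ¬ ShadowingProperty U := by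
  intro h
  obtain ⟨δ, hδ, h⟩ := h 1 one_pos
  have hstep : ∀ (n : ℤ) (z : HH), ((U ^ (n + 1) : (HH →L[ℂ] HH)ˣ) : HH →L[ℂ] HH) z =
      (U : HH →L[ℂ] HH) (((U ^ n : (HH →L[ℂ] HH)ˣ) : HH →L[ℂ] HH) z) := by
    intro n z
    rw [add_comm, zpow_one_add, Units.val_mul, mul_apply_eq_comp]
  obtain ⟨y, hy⟩ := h (fun n => if n < 0 then 0 else
    ((U ^ n : (HH →L[ℂ] HH)ˣ) : HH →L[ℂ] HH) ((δ : ℂ) • e 0)) (by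
      intro n
      rcases lt_trichotomy n (-1) with hn | hn | hn
      · simp [show n + 1 < 0 by omega, show n < 0 by omega, hδ.le]
      · subst hn
        have hne : ‖((δ : ℂ) • e 0 : HH)‖ = δ := by
          rw [norm_smul, norm_e, Complex.norm_real, Real.norm_of_nonneg hδ.le, mul_one]
        rw [if_neg (by norm_num), if_pos (by norm_num), map_zero, sub_zero, neg_add_cancel,
          zpow_zero, Units.val_one, one_apply_eq_self, hne]
      · simp only [show ¬ (n + 1 < 0) by omega, show ¬ (n < 0) by omega, if_false]
        rw [hstep, sub_self, norm_zero]; exact hδ.le)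
  have h1 : ((δ : ℂ) • e 0 - y : HH) 0 = 0 := by
    refine growth _ 1 _ (fun n => (n : ℤ)) (pow_coord U hU _) (.of_forall fun n => ?_)
    have := hy n
    simp only [show ¬ ((n : ℤ) < 0) by omega, if_false] at this
    rw [← map_sub, zpow_natCast, Units.val_pow_eq_pow_val] at this
    exact this
  have h2 : y 0 = 0 := by
    refine growth _ 1 _ (fun n => -(n : ℤ)) (pow_inv_coord U hU _) ?_
    filter_upwards [eventually_gt_atTop 0] with n hn
    have := hy (-(n : ℤ))
    simp only [show (-(n : ℤ) < 0) by omega, if_true] at this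
    rw [zero_sub, norm_neg, zpow_neg, ← inv_zpow, zpow_natCast, Units.val_pow_eq_pow_val] at this
    exact this
  have h3 : ((δ : ℂ) • e 0 - y : HH) 0 = δ * (e 0 : HH) 0 - y 0 := rfl
  rw [h1, h2, e_self] at h3
  simp at h3
  exact hδ.ne' (by exact_mod_cast h3.symm)

lemma unif_exp (U : (HH →L[ℂ] HH)ˣ) (hU : HC U) : UniformlyExpansive U := by
  refine ⟨1, one_pos, fun x hx => ?_⟩
  simp only [Nat.cast_one, zpow_one, zpow_neg]
  set a : HH := (U : HH →L[ℂ] HH) x with ha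
  set b : HH := ((U⁻¹ : (HH →L[ℂ] HH)ˣ) : HH →L[ℂ] HH) x with hb
  have hs : ∀ z : HH, HasSum (fun n : ℤ => ‖z n‖ ^ 2) (‖z‖ ^ 2) := by
    intro z
    have := lp.hasSum_norm (E := fun _ : ℤ => ℂ) (p := 2) (by norm_num) z
    simpa using this
  have sa := (Equiv.addRight (1 : ℤ)).hasSum_iff.2 (hs a)
  have sb := (Equiv.addRight (-1 : ℤ)).hasSum_iff.2 (hs b)
  have key : 8 * ‖x‖ ^ 2 ≤ ‖a‖ ^ 2 + ‖b‖ ^ 2 := by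
    refine hasSum_le (fun n => ?_) ((hs x).mul_left 8) (sa.add sb)
    simp only [Function.comp, Equiv.coe_addRight]
    have e1 : ‖a (n + 1)‖ ^ 2 = ww n ^ 2 * ‖x n‖ ^ 2 := by
      rw [ha, hU, norm_mul, Complex.norm_real, Real.norm_of_nonneg (ww_pos n).le, mul_pow]
    have e2 : ‖b (n + -1)‖ ^ 2 = ((ww (n + -1))⁻¹) ^ 2 * ‖x n‖ ^ 2 := by
      rw [hb, inv_coord U hU, norm_mul, norm_inv, Complex.norm_real,
        Real.norm_of_nonneg (ww_pos _).le, mul_pow, neg_add_cancel_right]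
    by_cases hn : 0 ≤ n
    · rw [e1, ww, if_pos hn, cc_sq]; nlinarith [sq_nonneg ‖b (n + -1)‖]
    · rw [e2, ww, if_neg (by omega), inv_inv, cc_sq]; nlinarith [sq_nonneg ‖a (n + 1)‖]
  rw [hx] at key
  by_contra! hc
  nlinarith [hc.1, hc.2, norm_nonneg a, norm_nonneg b]

/-- The bilateral weighted forward shift `T e_n = 2√2 e_{n+1}` (`n ≥ 0`),
`T e_n = (2√2)⁻¹ e_{n+1}` (`n ≤ -1`) on `ℓ²(ℤ, ℂ)` is an invertible operator which is
uniformly expansive but has neither the shadowing property nor is hyperbolic. -/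
theorem forward_shift_expansive_not_shadowing_not_hyperbolic
    (T : lp (fun _ : ℤ => ℂ) 2 →L[ℂ] lp (fun _ : ℤ => ℂ) 2)
    (hT₁ : ∀ n : ℤ, 0 ≤ n → T (e n) = ((2 * Real.sqrt 2 : ℝ) : ℂ) • e (n + 1))
    (hT₂ : ∀ n : ℤ, n ≤ -1 → T (e n) = (((2 * Real.sqrt 2 : ℝ)⁻¹ : ℝ) : ℂ) • e (n + 1)) :
    ∃ U : (lp (fun _ : ℤ => ℂ) 2 →L[ℂ] lp (fun _ : ℤ => ℂ) 2)ˣ,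
      (U : lp (fun _ : ℤ => ℂ) 2 →L[ℂ] lp (fun _ : ℤ => ℂ) 2) = T ∧
      UniformlyExpansive U ∧ ¬ ShadowingProperty U ∧ ¬ Hyperbolic U := by
  have hT : ∀ n, T (e n) = ((ww n : ℝ) : ℂ) • e (n + 1) := by
    intro n
    unfold ww
    split_ifs with h
    · exact hT₁ n h
    · exact hT₂ n (by omega)
  have hc := coordT T hT
  let E := ContinuousLinearEquiv.ofBijective T (LinearMap.ker_eq_bot.2 (injT T hc))
    (LinearMap.range_eq_top.2 (surjT T hc))
  let U := ContinuousLinearEquiv.toUnit E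
  have hUT : (U : HH →L[ℂ] HH) = T := by ext1 x; rfl
  have hU : HC U := by
    intro x n; rw [hUT]; exact hc x n
  exact ⟨U, hUT, unif_exp U hU, not_shad U hU, not_hyp U hU⟩
end
end
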